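/- arXiv:1109.4522 — 2 statements merged into one kernel-verified Lean document; each statement's English description precedes it below -/
import Mathlib

section
/- Let μ ⊢ n and λ ⊨ n, and let A be a row-standard μ-tableau of type λ. Write μ̃ = (μ_2, μ_3, …), let Ã be the μ̃-tableau obtained by deleting the first row of A, and let λ̃ be the type of Ã. Then there exists h ∈ H_n, depending only on μ, λ and λ̃ (and not otherwise on A), such that x_μ φ_A = h · Γ_{μ_1}(x_{μ̃} φ_{Ã}), where x_{μ̃} φ_{Ã} is computed in H_{n−μ_1}. -/
open scoped Classical

noncomputable section

namespace FayersSemistd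

/-- The value at `q` of the Gaussian (quantum) binomial coefficient polynomial
`[a choose b]`, defined via the `q`-Pascal recurrence. -/
def qBinom {F : Type*} [Field F] (q : F) : ℕ → ℕ → F
  | _, 0 => 1
  | 0, _+1 => 0
  | a+1, b+1 => qBinom q a b + q ^ (b+1) * qBinom q a (b+1)

/-- `∏_i [A_i + B_i choose A_i]_q`, where `A_i`, `B_i` are multiplicities in the
multisets `A` and `B`. -/
def qBinomProd {F : Type*} [Field F] (q : F) (A B : Multiset ℕ) : F :=
  ∏ i ∈ (A + B).toFinset, qBinom q ((A + B).count i) (A.count i)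

/-- `∑_{i<j} A_j * B_i` : the number of pairs `(x,y)` with `x ∈ A`, `y ∈ B`, `y < x`,
counted with multiplicity. -/
def invPairs (A B : Multiset ℕ) : ℕ :=
  ((A.product B).filter (fun p => p.2 < p.1)).card

/-- The Coxeter length of a permutation of `{0,…,n-1}`: its number of inversions. -/
def permLength {n : ℕ} (w : Equiv.Perm (Fin n)) : ℕ :=
  (Finset.univ.filter (fun p : Fin n × Fin n => p.1 < p.2 ∧ w p.2 < w p.1)).card

/-- `λ_0 + ⋯ + λ_{r-1}`. -/
def cumSum (lam : ℕ → ℕ) (r : ℕ) : ℕ := ∑ i ∈ Finset.range r, lam i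

/-- The (0-indexed) row of the diagram of `λ` containing the (0-indexed) position `p`,
when positions are listed row by row. -/
def rowOf (lam : ℕ → ℕ) (p : ℕ) : ℕ := sInf {r | p < cumSum lam (r+1)}

/-- `λ` is a composition of `n`: finitely many nonzero parts, summing to `n`. -/
def IsComposition (n : ℕ) (lam : ℕ → ℕ) : Prop :=
  ∃ N, (∀ r, N ≤ r → lam r = 0) ∧ cumSum lam N = n

/-- `μ` is a partition of `n`. -/
def IsPartition (n : ℕ) (mu : ℕ → ℕ) : Prop := IsComposition n mu ∧ Antitone mu

/-- The conjugate partition (0-indexed): `conjP μ i = #{r | μ r > i}`. -/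
def conjP (mu : ℕ → ℕ) (i : ℕ) : ℕ := sInf {r | mu r ≤ i}

/-- The standard Young subgroup `W_λ` of `S_n` (as a set): the permutations preserving
each consecutive block of sizes `λ_0, λ_1, …`. -/
def youngW {n : ℕ} (lam : ℕ → ℕ) : Set (Equiv.Perm (Fin n)) :=
  {w | ∀ p : Fin n, rowOf lam ((w p : Fin n) : ℕ) = rowOf lam (p : ℕ)}

/-- The adjacent transposition `(i, i+1)` (0-indexed) in `S_n`. -/
def adjT {n : ℕ} (i : ℕ) (h : i + 1 < n) : Equiv.Perm (Fin n) :=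
  Equiv.swap ⟨i, Nat.lt_of_succ_lt h⟩ ⟨i+1, h⟩

/-- `T : S_n → H` is the standard basis of an Iwahori–Hecke algebra of `S_n` over `F`
with parameter `q`.  Permutations act on the right, so the product `w·s` of the paper
is `s * w` in Mathlib's convention; the multiplication rule
`T_w T_s = T_{ws}` (length increasing) resp. `T_w T_s = q T_{ws} + (q-1) T_w`
(length decreasing) determines the algebra structure on the basis. -/
structure IsHeckeBasis {F : Type*} [Field F] {H : Type*} [Ring H] [Algebra F H] {n : ℕ}
    (q : F) (T : Equiv.Perm (Fin n) → H) : Prop where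
  li : LinearIndependent F T
  total : Submodule.span F (Set.range T) = ⊤
  one : T 1 = 1
  mul_adj_asc : ∀ (w : Equiv.Perm (Fin n)) (i : ℕ) (h : i + 1 < n),
    permLength w < permLength (adjT i h * w) →
    T w * T (adjT i h) = T (adjT i h * w)
  mul_adj_desc : ∀ (w : Equiv.Perm (Fin n)) (i : ℕ) (h : i + 1 < n),
    permLength (adjT i h * w) < permLength w →
    T w * T (adjT i h) = q • T (adjT i h * w) + (q - 1) • T w

variable {F : Type*} [Field F] {H : Type*} [Ring H] [Algebra F H] {n : ℕ}

/-- `x_λ = ∑_{w ∈ W_λ} T_w`. -/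
def xElt (T : Equiv.Perm (Fin n) → H) (lam : ℕ → ℕ) : H :=
  ∑ w ∈ Finset.univ.filter (· ∈ youngW lam), T w

/-- `y_λ = ∑_{w ∈ W_λ} (-q)^{-l(w)} T_w`. -/
def yElt (q : F) (T : Equiv.Perm (Fin n) → H) (lam : ℕ → ℕ) : H :=
  ∑ w ∈ Finset.univ.filter (· ∈ youngW lam), ((-q)⁻¹) ^ permLength w • T w

/-- The double coset `W_λ d W_μ` (paper convention: maps act on the right, so the
paper product `u·d·v` is `v * d * u` in Mathlib's convention). -/
def doubleCoset {n : ℕ} (lam mu : ℕ → ℕ) (d : Equiv.Perm (Fin n)) :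
    Set (Equiv.Perm (Fin n)) :=
  {w | ∃ u ∈ youngW (n := n) lam, ∃ v ∈ youngW (n := n) mu, w = v * d * u}

/-- `∑_{w ∈ W_λ 1_A W_μ} T_w`, the image `x_μ φ_A` of `x_μ` under the tableau
homomorphism `φ_A : M^μ → M^λ`, where `d = 1_A`. -/
def XPhi (T : Equiv.Perm (Fin n) → H) (lam mu : ℕ → ℕ) (d : Equiv.Perm (Fin n)) : H :=
  ∑ w ∈ Finset.univ.filter (· ∈ doubleCoset lam mu d), T w

/-- A row-standard tableau is recorded by the multisets of entries of its rows; it has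
shape `μ` when row `r` has `μ_r` entries. -/
def RowsOfShape (mu : ℕ → ℕ) (A : ℕ → Multiset ℕ) : Prop := ∀ r, (A r).card = mu r

/-- The tableau with rows `A 0, A 1, …` has type `λ` when the entry `v` occurs `λ_v`
times in total (entries and types are 0-indexed). -/
def HasType (A : ℕ → Multiset ℕ) (lam : ℕ → ℕ) : Prop :=
  ∀ v, (∑ᶠ r, (A r).count v) = lam v

/-- The entry in row `r`, column `c` (0-indexed) of the row-standard tableau with row
multisets `A`. -/
def entryAt (A : ℕ → Multiset ℕ) (r c : ℕ) : ℕ := ((A r).sort (· ≤ ·)).getD c 0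

/-- `d = 1_A` for the row-standard `μ`-tableau `A` of type `λ`: the tableau `t^λ d`
(whose entry at position `p` is `d p`) is row-standard (first clause), and the entry
`d p` lies in row `r` of `t^λ d` exactly when the position occupied by `d p` in `t^μ`
is occupied by `r` in `A` (second clause). -/
def Is1A {n : ℕ} (mu lam : ℕ → ℕ) (A : ℕ → Multiset ℕ) (d : Equiv.Perm (Fin n)) : Prop :=
  (∀ p p' : Fin n, rowOf lam (p : ℕ) = rowOf lam (p' : ℕ) → p < p' → d p < d p') ∧
  (∀ p : Fin n,
    entryAt A (rowOf mu ((d p : Fin n) : ℕ))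
      (((d p : Fin n) : ℕ) - cumSum mu (rowOf mu ((d p : Fin n) : ℕ)))
      = rowOf lam (p : ℕ))

/-- A row-standard tableau is semistandard if its columns are strictly increasing. -/
def Semistandard (mu : ℕ → ℕ) (A : ℕ → Multiset ℕ) : Prop :=
  ∀ r c, c < mu (r+1) → entryAt A r c < entryAt A (r+1) c

/-- The (0-indexed) column of the position `p` in the diagram of `μ`. -/
def colIdx (mu : ℕ → ℕ) (p : ℕ) : ℕ := p - cumSum mu (rowOf mu p)

/-- `w = w_μ`, i.e. `t^μ w = t_μ`: the image of position `p` is the number of positions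
coming strictly before `p` in the column-reading order of the diagram of `μ`. -/
def IsWmu {n : ℕ} (mu : ℕ → ℕ) (w : Equiv.Perm (Fin n)) : Prop :=
  ∀ p : Fin n, ((w p : Fin n) : ℕ) = (Finset.univ.filter (fun p' : Fin n =>
    colIdx mu (p' : ℕ) < colIdx mu (p : ℕ) ∨
      (colIdx mu (p' : ℕ) = colIdx mu (p : ℕ) ∧ rowOf mu (p' : ℕ) < rowOf mu (p : ℕ)))).card

def comp1 (a : ℕ) : ℕ → ℕ := fun r => if r = 0 then a else 0
def comp2 (a b : ℕ) : ℕ → ℕ := fun r => if r = 0 then a else if r = 1 then b else 0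
def comp3 (a b c : ℕ) : ℕ → ℕ :=
  fun r => if r = 0 then a else if r = 1 then b else if r = 2 then c else 0
def comp4 (a b c d : ℕ) : ℕ → ℕ :=
  fun r => if r = 0 then a else if r = 1 then b else if r = 2 then c else if r = 3 then d else 0
def rows1 (a : Multiset ℕ) : ℕ → Multiset ℕ := fun r => if r = 0 then a else 0
def rows2 (a b : Multiset ℕ) : ℕ → Multiset ℕ :=
  fun r => if r = 0 then a else if r = 1 then b else 0
def rows3 (a b c : Multiset ℕ) : ℕ → Multiset ℕ :=
  fun r => if r = 0 then a else if r = 1 then b else if r = 2 then c else 0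
def rows4 (a b c d : Multiset ℕ) : ℕ → Multiset ℕ :=
  fun r => if r = 0 then a else if r = 1 then b else if r = 2 then c else if r = 3 then d else 0

end FayersSemistd
namespace FayersSemistd

theorem mul_inv_apply_adjT {n : ℕ} (w : Equiv.Perm (Fin n)) {i : ℕ} (h : i + 1 < n)
    (p : Fin n) : (adjT i h * w)⁻¹ p = w⁻¹ (adjT i h p) := by
  simp [adjT, mul_inv_rev]

/-- Left multiplication by an adjacent transposition which creates an inversion increases the
length. -/
theorem permLength_lt_adjT_mul {n : ℕ} (w : Equiv.Perm (Fin n)) (i : ℕ) (h : i + 1 < n)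
    (hw : w⁻¹ ⟨i, Nat.lt_of_succ_lt h⟩ < w⁻¹ ⟨i + 1, h⟩) :
    permLength w < permLength (adjT i h * w) := by
  unfold permLength
  apply Finset.card_lt_card
  rw [Finset.ssubset_iff_of_subset]
  · refine ⟨(w⁻¹ ⟨i, Nat.lt_of_succ_lt h⟩, w⁻¹ ⟨i + 1, h⟩), ?_, ?_⟩
    · rw [Finset.mem_filter]
      simpa [adjT] using hw
    · rw [Finset.mem_filter]
      simp
  · rintro ⟨a, b⟩ hab
    rw [Finset.mem_filter] at hab ⊢
    replace hab := hab.2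
    refine ⟨Finset.mem_univ _, hab.1, ?_⟩
    by_cases hc : w b = ⟨i, Nat.lt_of_succ_lt h⟩ ∧ w a = ⟨i + 1, h⟩
    · rw [← hc.1, ← hc.2, show w⁻¹ (w b) = b by simp, show w⁻¹ (w a) = a by simp] at hw
      exact absurd hab.1 hw.not_gt
    · have h2 := hab.2
      simp only [adjT, Equiv.swap_apply_def, Equiv.Perm.mul_apply]
      simp only [Fin.ext_iff, Fin.lt_def, apply_ite Fin.val] at *
      split_ifs <;> omega

/-- A nontrivial permutation has a descent. -/
theorem exists_inv_descent {n : ℕ} (s : Equiv.Perm (Fin n)) (hs : s ≠ 1) :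
    ∃ (i : ℕ) (h : i + 1 < n), s⁻¹ ⟨i + 1, h⟩ < s⁻¹ ⟨i, Nat.lt_of_succ_lt h⟩ := by
  by_contra! hcon
  apply hs
  have hmono : Monotone (s⁻¹ : Equiv.Perm (Fin n)) := by
    cases n with
    | zero => exact fun a => a.elim0
    | succ n =>
      exact Fin.monotone_iff_le_succ.2 fun i => hcon i (by omega)
  have h := Tuple.unique_monotone (f := (id : Fin n → Fin n)) (σ := s⁻¹) (τ := 1)
    hmono monotone_id
  exact inv_eq_one.1 (Equiv.ext fun x => congrFun h x)

/-- The embedding of `Fin m` onto the last `m` elements of `Fin n`. -/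
def tailEmb {n m k : ℕ} (h : k + m = n) : Fin m ↪ Fin n where
  toFun j := ⟨j + k, by omega⟩
  inj' a b hab := by
    simp only [Fin.mk.injEq] at hab
    exact Fin.ext (by omega)

theorem tailEmb_val {n m k : ℕ} (h : k + m = n) (j : Fin m) : (tailEmb h j : ℕ) = j + k := rfl

/-- The shift embedding `S_m → S_n`, permuting the last `m` elements. -/
def shiftHom {n m k : ℕ} (h : k + m = n) : Equiv.Perm (Fin m) →* Equiv.Perm (Fin n) :=
  Equiv.Perm.viaEmbeddingHom (tailEmb h)

theorem shiftHom_tail {n m k : ℕ} (h : k + m = n) (s : Equiv.Perm (Fin m)) (j : Fin m) :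
    shiftHom h s (tailEmb h j) = tailEmb h (s j) :=
  Equiv.Perm.viaEmbedding_apply s (tailEmb h) j

theorem exists_tailEmb_eq {n m k : ℕ} (h : k + m = n) (p : Fin n) (hp : k ≤ p) :
    ∃ j, tailEmb h j = p :=
  ⟨⟨p - k, by omega⟩, Fin.ext (Nat.sub_add_cancel hp)⟩

theorem shiftHom_head {n m k : ℕ} (h : k + m = n) (s : Equiv.Perm (Fin m)) (p : Fin n)
    (hp : (p : ℕ) < k) : shiftHom h s p = p := by
  refine Equiv.Perm.viaEmbedding_apply_of_notMem s (tailEmb h) p ?_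
  rintro ⟨j, rfl⟩
  rw [tailEmb_val] at hp
  omega

theorem shiftHom_inv_mul_inv_tail {n m k : ℕ} (h : k + m = n) (s : Equiv.Perm (Fin m))
    (e : Equiv.Perm (Fin n)) (j : Fin m) :
    (shiftHom h s * e)⁻¹ (tailEmb h j) = e⁻¹ (tailEmb h (s⁻¹ j)) := by
  rw [mul_inv_rev, Equiv.Perm.mul_apply, ← map_inv, shiftHom_tail]

theorem shiftHom_adjT {n m k : ℕ} (h : k + m = n) (i : ℕ) (hi : i + 1 < m) :
    shiftHom h (adjT i hi) = adjT (i + k) (by omega) := by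
  ext p
  rcases lt_or_ge (p : ℕ) k with hp | hp
  · rw [shiftHom_head h _ _ hp, adjT, Equiv.swap_apply_of_ne_of_ne] <;>
      simp only [ne_eq, Fin.ext_iff] <;> omega
  · obtain ⟨j, rfl⟩ := exists_tailEmb_eq h p hp
    rw [shiftHom_tail]
    simp only [adjT, Equiv.swap_apply_def, Fin.ext_iff, tailEmb_val]
    split_ifs <;> simp only [tailEmb_val] <;> omega

/-- If `e` is a minimal coset representative for the shifted copy of `S_m`, then
`T_e Γ(T_s) = T_{e s}`. -/
theorem mul_map_eq_shiftHom_mul {F : Type*} [Field F] {H : Type*} [Ring H] [Algebra F H]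
    {H' : Type*} [Ring H'] [Algebra F H'] {n m k : ℕ} (h : k + m = n) {q : F}
    {T : Equiv.Perm (Fin n) → H} (hT : IsHeckeBasis q T)
    {T' : Equiv.Perm (Fin m) → H'} (hT' : IsHeckeBasis q T') (g : H' →ₐ[F] H)
    (hg : ∀ (i : ℕ) (hi : i + 1 < m), g (T' (adjT i hi)) = T (adjT (i + k) (by omega)))
    (e : Equiv.Perm (Fin n)) (he : StrictMono fun j => e⁻¹ (tailEmb h j))
    (s : Equiv.Perm (Fin m)) : T e * g (T' s) = T (shiftHom h s * e) := by
  induction hl : permLength s using Nat.strong_induction_on generalizing s with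
  | _ l ih =>
    by_cases hs : s = 1
    · rw [hs, hT'.one, map_one, map_one, mul_one, one_mul]
    · obtain ⟨i, hi, hd⟩ := exists_inv_descent s hs
      obtain ⟨s₁, rfl⟩ : ∃ s₁, s = adjT i hi * s₁ := ⟨adjT i hi * s, by simp [adjT, ← mul_assoc]⟩
      simp only [mul_inv_apply_adjT] at hd
      simp only [adjT, Equiv.swap_apply_left, Equiv.swap_apply_right] at hd
      have hlt := permLength_lt_adjT_mul s₁ i hi hd
      have hlt' : permLength (shiftHom h s₁ * e) <
          permLength (adjT (i + k) (by omega) * (shiftHom h s₁ * e)) := by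
        apply permLength_lt_adjT_mul
        have h1 := shiftHom_inv_mul_inv_tail h s₁ e ⟨i, by omega⟩
        have h2 := shiftHom_inv_mul_inv_tail h s₁ e ⟨i + 1, hi⟩
        have h3 : tailEmb h ⟨i + 1, hi⟩ = ⟨i + k + 1, by omega⟩ := 
          Fin.ext (by rw [tailEmb_val]; simp only []; omega)
        rw [h3] at h2
        change (shiftHom h s₁ * e)⁻¹ (tailEmb h ⟨i, by omega⟩) < _
        rw [h1, h2]
        exact he hd
      rw [← hT'.mul_adj_asc s₁ i hi hlt, map_mul, ← mul_assoc, ih _ (hl ▸ hlt) s₁ rfl, hg,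
        hT.mul_adj_asc _ _ _ hlt', map_mul, shiftHom_adjT, mul_assoc]

theorem IsComposition.exists_lt_cumSum {n : ℕ} {lam : ℕ → ℕ} (h : IsComposition n lam) {p : ℕ}
    (hp : p < n) : ∃ r, p < cumSum lam (r + 1) := by
  obtain ⟨N, -, hN⟩ := h
  refine ⟨N, ?_⟩
  rw [cumSum, Finset.sum_range_succ, ← cumSum]
  omega

theorem IsComposition.apply_zero_le {n : ℕ} {lam : ℕ → ℕ} (h : IsComposition n lam) : lam 0 ≤ n := by
  obtain ⟨N, h0, hN⟩ := h
  cases N with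
  | zero => simp [h0 0 le_rfl]
  | succ N => rw [cumSum, Finset.sum_range_succ'] at hN; omega

theorem rowOf_le_rowOf {n : ℕ} {lam : ℕ → ℕ} (h : IsComposition n lam) {p p' : ℕ}
    (hp : p ≤ p') (hp' : p' < n) : rowOf lam p ≤ rowOf lam p' := by
  have := Nat.sInf_mem (s := {r | p' < cumSum lam (r + 1)}) (h.exists_lt_cumSum hp')
  exact Nat.sInf_le (lt_of_le_of_lt hp this)

theorem cumSum_succ_eq (mu : ℕ → ℕ) (r : ℕ) :
    cumSum mu (r + 1) = cumSum (fun s => mu (s + 1)) r + mu 0 :=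
  Finset.sum_range_succ' _ _

theorem rowOf_add {n : ℕ} {mu : ℕ → ℕ} (h : IsComposition n mu) {j : ℕ}
    (hj : j + mu 0 < n) : rowOf mu (j + mu 0) = rowOf (fun s => mu (s + 1)) j + 1 := by
  have h1 : 1 ≤ sInf {r | j + mu 0 < cumSum mu (r + 1)} := by
    have hm := Nat.sInf_mem (s := {r | j + mu 0 < cumSum mu (r + 1)}) (h.exists_lt_cumSum hj)
    by_contra! hlt
    rw [Nat.lt_one_iff.1 hlt] at hm
    simp [cumSum] at hm
  rw [rowOf, rowOf, ← Nat.sInf_add h1]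
  simp only [cumSum_succ_eq mu, Nat.add_lt_add_iff_right]

theorem rowOf_eq_zero {mu : ℕ → ℕ} {p : ℕ} (hp : p < mu 0) : rowOf mu p = 0 :=
  Nat.sInf_eq_zero.2 (Or.inl (by simpa [cumSum] using hp))

/-- Two functions on a finite type take the same values with the same multiplicities iff they
differ by a permutation. -/
theorem map_univ_val_eq_iff {α β : Type*} [Fintype α] (f f' : α → β) :
    (Finset.univ : Finset α).val.map f = (Finset.univ : Finset α).val.map f' ↔
      ∃ σ : Equiv.Perm α, f = f' ∘ σ := by
  constructor
  · intro h
    have hcard : ∀ b, Nonempty ({a // f a = b} ≃ {a // f' a = b}) := by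
      intro b
      have hb := congrArg (Multiset.count b) h
      simp only [Multiset.count_map, ← Finset.filter_val, Finset.card_val, eq_comm (a := b)] at hb
      rw [← Fintype.card_eq, Fintype.card_subtype, Fintype.card_subtype]
      convert hb
    exact ⟨Equiv.ofFiberEquiv fun b => (hcard b).some,
      funext fun a => (Equiv.ofFiberEquiv_map _ a).symm⟩
  · rintro ⟨σ, rfl⟩
    rw [← Multiset.map_map, Multiset.map_univ_val_equiv]

/-- The word of `w`: the row of `t^λ w` which contains a given entry. -/
def rowWord {n : ℕ} (lam : ℕ → ℕ) (w : Equiv.Perm (Fin n)) (p : Fin n) : ℕ :=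
  rowOf lam (w⁻¹ p : Fin n)

theorem map_rowWord {n : ℕ} (lam : ℕ → ℕ) (w : Equiv.Perm (Fin n)) :
    (Finset.univ : Finset (Fin n)).val.map (rowWord lam w) =
      (Finset.univ : Finset (Fin n)).val.map fun p : Fin n => rowOf lam p :=
  (map_univ_val_eq_iff _ _).2 ⟨w⁻¹, rfl⟩

/-- Membership in a double coset only depends on the contents of the word on each row. -/
theorem mem_doubleCoset_iff {n : ℕ} (lam mu : ℕ → ℕ) (d w : Equiv.Perm (Fin n)) :
    w ∈ doubleCoset lam mu d ↔
      (Finset.univ : Finset (Fin n)).val.map (fun p : Fin n => (rowOf mu p, rowWord lam w p)) =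
        (Finset.univ : Finset (Fin n)).val.map (fun p : Fin n => (rowOf mu p, rowWord lam d p)) := by
  rw [map_univ_val_eq_iff]
  simp only [funext_iff, Function.comp_apply, Prod.mk.injEq, rowWord]
  constructor
  · rintro ⟨u, hu, v, hv, rfl⟩
    refine ⟨v⁻¹, fun p => ⟨?_, ?_⟩⟩
    · simpa using hv (v⁻¹ p)
    · simpa [mul_inv_rev] using (hu (u⁻¹ (d⁻¹ (v⁻¹ p)))).symm
  · rintro ⟨v, hv⟩
    refine ⟨d⁻¹ * v * w, fun p => ?_, v⁻¹, fun p => ?_, by group⟩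
    · simpa using (hv (w p)).2.symm
    · simpa using (hv (v⁻¹ p)).1

theorem map_univ_eq_head_add_tail {n m k : ℕ} (h : k + m = n) {β : Type*} (f : Fin n → β) :
    (Finset.univ : Finset (Fin n)).val.map f =
      (Finset.univ.filter fun p : Fin n => (p : ℕ) < k).val.map f +
        (Finset.univ : Finset (Fin m)).val.map fun j => f (tailEmb h j) := by
  have h1 : (Finset.univ.filter fun p : Fin n => ¬ (p : ℕ) < k) =
      Finset.univ.map (tailEmb h) := by
    ext p
    simp only [Finset.mem_filter, Finset.mem_univ, true_and, Finset.mem_map, not_lt]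
    refine ⟨exists_tailEmb_eq h p, ?_⟩
    rintro ⟨j, rfl⟩
    rw [tailEmb_val]
    omega
  have h2 : (Finset.univ : Finset (Fin m)).val.map (fun j => f (tailEmb h j)) =
      (Finset.univ.filter fun p : Fin n => ¬ (p : ℕ) < k).val.map f := by
    rw [h1, Finset.map_val, Multiset.map_map]
    rfl
  rw [h2, ← Multiset.map_add, Finset.filter_val, Finset.filter_val, Multiset.filter_add_not]

/-- For words of equal content, the row contents agree as soon as they agree below the top
row. -/
theorem map_row_eq_iff_tail {n m k : ℕ} (h : k + m = n) (R f f' : Fin n → ℕ)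
    (hR : ∀ p : Fin n, (p : ℕ) < k → R p = 0) (hR' : ∀ j, R (tailEmb h j) ≠ 0)
    (hf : (Finset.univ : Finset (Fin n)).val.map f = (Finset.univ : Finset (Fin n)).val.map f') :
    (Finset.univ : Finset (Fin n)).val.map (fun p => (R p, f p)) =
        (Finset.univ : Finset (Fin n)).val.map (fun p => (R p, f' p)) ↔
      (Finset.univ : Finset (Fin m)).val.map (fun j => (R (tailEmb h j), f (tailEmb h j))) =
        (Finset.univ : Finset (Fin m)).val.map
          (fun j => (R (tailEmb h j), f' (tailEmb h j))) := by
  have hhead : ∀ f : Fin n → ℕ,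
      (Finset.univ.filter fun p : Fin n => (p : ℕ) < k).val.map (fun p => (R p, f p)) =
        ((Finset.univ.filter fun p : Fin n => (p : ℕ) < k).val.map f).map (Prod.mk 0) := by
    intro f
    rw [Multiset.map_map]
    refine Multiset.map_congr rfl fun p hp => ?_
    rw [Finset.mem_val, Finset.mem_filter] at hp
    simp [hR p hp.2]
  rw [map_univ_eq_head_add_tail h, map_univ_eq_head_add_tail h (fun p => (R p, f' p)),
    hhead, hhead]
  constructor
  · intro heq
    have hfil := congrArg (Multiset.filter fun x : ℕ × ℕ => x.1 ≠ 0) heq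
    have hz : ∀ s : Multiset ℕ, (s.map (Prod.mk 0)).filter (fun x : ℕ × ℕ => x.1 ≠ 0) = 0 := by
      intro s
      simp [Multiset.filter_eq_nil]
    have ht : ∀ f : Fin n → ℕ, ((Finset.univ : Finset (Fin m)).val.map
        (fun j => (R (tailEmb h j), f (tailEmb h j)))).filter (fun x : ℕ × ℕ => x.1 ≠ 0) =
        (Finset.univ : Finset (Fin m)).val.map
          (fun j => (R (tailEmb h j), f (tailEmb h j))) := by
      intro f
      rw [Multiset.filter_eq_self]
      simpa using hR'
    rwa [Multiset.filter_add, Multiset.filter_add, hz, hz, ht, ht, zero_add, zero_add] at hfil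
  · intro htail
    have hsnd := congrArg (Multiset.map Prod.snd) htail
    simp only [Multiset.map_map, Function.comp_def] at hsnd
    rw [map_univ_eq_head_add_tail h, map_univ_eq_head_add_tail h f', hsnd] at hf
    rw [htail, add_right_cancel hf]

/-- The word of `1_A` lists the entries of `A`. -/
theorem Is1A.rowWord_eq {n : ℕ} {mu lam : ℕ → ℕ} {A : ℕ → Multiset ℕ}
    {d : Equiv.Perm (Fin n)} (h : Is1A mu lam A d) (p : Fin n) :
    rowWord lam d p = entryAt A (rowOf mu p) ((p : ℕ) - cumSum mu (rowOf mu p)) := by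
  have := h.2 (d⁻¹ p)
  rw [show d (d⁻¹ p) = p by simp] at this
  exact this.symm

/-- The minimal coset representatives `e` for the shifted copy of `S_m` such that the word of
`e` ends with the increasing word of type `λ̃`. -/
def topReps {n m k : ℕ} (h : k + m = n) (lam lamt : ℕ → ℕ) : Finset (Equiv.Perm (Fin n)) :=
  Finset.univ.filter fun e =>
    (StrictMono fun j => e⁻¹ (tailEmb h j)) ∧ ∀ j, rowWord lam e (tailEmb h j) = rowOf lamt j

/-- Factorisation through the shifted copy of `S_m` with a minimal coset representative. -/
theorem exists_shiftHom_mul_eq {n m k : ℕ} (h : k + m = n) (w : Equiv.Perm (Fin n)) :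
    ∃ (e : Equiv.Perm (Fin n)) (s : Equiv.Perm (Fin m)),
      (StrictMono fun j => e⁻¹ (tailEmb h j)) ∧ shiftHom h s * e = w := by
  let f : Fin m → Fin n := fun j => w⁻¹ (tailEmb h j)
  let s := Tuple.sort f
  refine ⟨(shiftHom h s)⁻¹ * w, s, ?_, by group⟩
  have hf : (fun j => ((shiftHom h s)⁻¹ * w)⁻¹ (tailEmb h j)) = f ∘ s := by
    funext j
    simp [mul_inv_rev, shiftHom_tail, f]
  rw [hf]
  exact (Tuple.monotone_sort f).strictMono_of_injective
    (((w⁻¹).injective.comp (tailEmb h).injective).comp s.injective)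

theorem shiftHom_mul_injective {n m k : ℕ} (h : k + m = n) {e₁ e₂ : Equiv.Perm (Fin n)}
    {s₁ s₂ : Equiv.Perm (Fin m)} (h₁ : StrictMono fun j => e₁⁻¹ (tailEmb h j))
    (h₂ : StrictMono fun j => e₂⁻¹ (tailEmb h j))
    (heq : shiftHom h s₁ * e₁ = shiftHom h s₂ * e₂) : e₁ = e₂ ∧ s₁ = s₂ := by
  have hs : s₂⁻¹ * s₁ = 1 := by
    have hc : (fun j => e₁⁻¹ (tailEmb h j)) =
        (fun j => e₂⁻¹ (tailEmb h j)) ∘ (s₂⁻¹ * s₁ : Equiv.Perm (Fin m)) := by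
      funext j
      have := shiftHom_inv_mul_inv_tail h s₁ e₁ (s₁ j)
      rw [heq, shiftHom_inv_mul_inv_tail] at this
      simpa using this.symm
    have hu := Tuple.unique_monotone (f := fun j => e₂⁻¹ (tailEmb h j)) (σ := s₂⁻¹ * s₁)
      (τ := 1) (hc ▸ h₁.monotone) h₂.monotone
    exact Equiv.ext fun j => h₂.injective (congrFun hu j)
  have hs' : s₁ = s₂ := (inv_mul_eq_one.1 hs).symm
  subst hs'
  exact ⟨mul_left_cancel heq, rfl⟩

/-- The double coset of `1_A` factors through that of `1_Ã`. -/
theorem shiftHom_mul_mem_doubleCoset_iff {n m : ℕ} {mu lam lamt : ℕ → ℕ} (h : mu 0 + m = n)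
    (hmu : IsComposition n mu) (hlam : IsComposition n lam) (hlamt : IsComposition m lamt)
    {A : ℕ → Multiset ℕ} {d : Equiv.Perm (Fin n)} {dt : Equiv.Perm (Fin m)}
    (hd : Is1A mu lam A d)
    (hdt : Is1A (fun s => mu (s + 1)) lamt (fun s => A (s + 1)) dt)
    {e : Equiv.Perm (Fin n)} (he : StrictMono fun j => e⁻¹ (tailEmb h j))
    (s : Equiv.Perm (Fin m)) :
    shiftHom h s * e ∈ doubleCoset lam mu d ↔
      e ∈ topReps h lam lamt ∧ s ∈ doubleCoset lamt (fun s => mu (s + 1)) dt := by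
  have hrow : ∀ j : Fin m,
      rowOf mu (tailEmb h j : Fin n) = rowOf (fun s => mu (s + 1)) j + 1 :=
    fun j => rowOf_add hmu (by omega)
  have hword : ∀ j, rowWord lam d (tailEmb h j) = rowWord lamt dt j := by
    intro j
    rw [hd.rowWord_eq, hdt.rowWord_eq, hrow, cumSum_succ_eq]
    have hval : ((tailEmb h j : Fin n) : ℕ) = j + mu 0 := rfl
    rw [hval, Nat.add_sub_add_right]
    rfl
  have hwtail : ∀ j, rowWord lam (shiftHom h s * e) (tailEmb h j) =
      rowWord lam e (tailEmb h (s⁻¹ j)) := fun j => by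
    rw [rowWord, shiftHom_inv_mul_inv_tail, rowWord]
  rw [mem_doubleCoset_iff, mem_doubleCoset_iff, map_row_eq_iff_tail h _ _ _
    (fun p hp => rowOf_eq_zero hp) (fun j => by simp [hrow])
    ((map_rowWord lam _).trans (map_rowWord lam d).symm)]
  simp only [hrow, hword, hwtail]
  have hinj : ∀ f f' : Fin m → ℕ,
      (Finset.univ : Finset (Fin m)).val.map
          (fun j : Fin m => (rowOf (fun s => mu (s + 1)) j + 1, f j)) =
        (Finset.univ : Finset (Fin m)).val.map
          (fun j : Fin m => (rowOf (fun s => mu (s + 1)) j + 1, f' j)) ↔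
      (Finset.univ : Finset (Fin m)).val.map (fun j : Fin m => (rowOf (fun s => mu (s + 1)) j, f j)) =
        (Finset.univ : Finset (Fin m)).val.map
          (fun j : Fin m => (rowOf (fun s => mu (s + 1)) j, f' j)) := by
    intro f f'
    simp only [map_univ_val_eq_iff, funext_iff, Function.comp_apply, Prod.mk.injEq,
      Nat.add_right_cancel_iff]
  rw [hinj]
  refine (and_iff_right_of_imp (a := ∀ j, rowWord lam e (tailEmb h j) = rowOf lamt j)
    ?_).symm.trans ?_
  rotate_left
  · simp only [topReps, Finset.mem_filter, Finset.mem_univ, true_and, he]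
    refine and_congr_right fun hw => ?_
    simp only [hw]
    rfl
  · intro heq j
    have hsnd := congrArg (Multiset.map Prod.snd) heq
    simp only [Multiset.map_map, Function.comp_def] at hsnd
    have hcont := hsnd.trans (map_rowWord lamt dt)
    rw [map_univ_val_eq_iff] at hcont
    obtain ⟨σ, hσ⟩ := hcont
    have hc : (fun j => rowWord lam e (tailEmb h j)) =
        (fun j : Fin m => rowOf lamt j) ∘ (σ * s : Equiv.Perm (Fin m)) := by
      funext j
      simpa using congrFun hσ (s j)
    have hmono : Monotone fun j => rowWord lam e (tailEmb h j) :=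
      fun a b hab => rowOf_le_rowOf hlam (he.monotone hab) (Fin.isLt _)
    have hu := Tuple.unique_monotone (f := fun j : Fin m => rowOf lamt j) (σ := σ * s) (τ := 1)
      (hc ▸ hmono) (fun a b hab => rowOf_le_rowOf hlamt hab b.isLt)
    exact congrFun (hc.trans hu) j

theorem xPhi_eq_sum_topReps_mul {F : Type*} [Field F] {H : Type*} [Ring H] [Algebra F H]
    {H' : Type*} [Ring H'] [Algebra F H'] {n m : ℕ} {q : F} {mu lam lamt : ℕ → ℕ}
    (h : mu 0 + m = n)
    (hmu : IsComposition n mu) (hlam : IsComposition n lam) (hlamt : IsComposition m lamt)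
    {T : Equiv.Perm (Fin n) → H} (hT : IsHeckeBasis q T)
    {T' : Equiv.Perm (Fin m) → H'} (hT' : IsHeckeBasis q T') (g : H' →ₐ[F] H)
    (hg : ∀ (i : ℕ) (hi : i + 1 < m), g (T' (adjT i hi)) = T (adjT (i + mu 0) (by omega)))
    {A : ℕ → Multiset ℕ} {d : Equiv.Perm (Fin n)} {dt : Equiv.Perm (Fin m)}
    (hd : Is1A mu lam A d)
    (hdt : Is1A (fun s => mu (s + 1)) lamt (fun s => A (s + 1)) dt) :
    XPhi T lam mu d =
      (∑ e ∈ topReps h lam lamt, T e) * g (XPhi T' lamt (fun s => mu (s + 1)) dt) := by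
  have hmin : ∀ e ∈ topReps h lam lamt, StrictMono fun j => e⁻¹ (tailEmb h j) :=
    fun e he => (Finset.mem_filter.1 he).2.1
  rw [XPhi, XPhi, map_sum, Finset.sum_mul_sum, ← Finset.sum_product']
  symm
  refine Finset.sum_bij (fun x _ => shiftHom h x.2 * x.1) ?_ ?_ ?_ ?_
  · rintro ⟨e, s⟩ hx
    rw [Finset.mem_product, Finset.mem_filter] at hx
    rw [Finset.mem_filter]
    exact ⟨Finset.mem_univ _, (shiftHom_mul_mem_doubleCoset_iff h hmu hlam hlamt hd hdt
      (hmin _ hx.1) _).2 ⟨hx.1, hx.2.2⟩⟩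
  · rintro ⟨e₁, s₁⟩ hx₁ ⟨e₂, s₂⟩ hx₂ heq
    rw [Finset.mem_product] at hx₁ hx₂
    obtain ⟨rfl, rfl⟩ := shiftHom_mul_injective h (hmin _ hx₁.1) (hmin _ hx₂.1) heq
    rfl
  · intro w hw
    obtain ⟨e, s, he, rfl⟩ := exists_shiftHom_mul_eq h w
    have := (shiftHom_mul_mem_doubleCoset_iff h hmu hlam hlamt hd hdt he s).1
      (Finset.mem_filter.1 hw).2
    exact ⟨(e, s), Finset.mem_product.2
      ⟨this.1, Finset.mem_filter.2 ⟨Finset.mem_univ _, this.2⟩⟩, rfl⟩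
  · rintro ⟨e, s⟩ hx
    exact mul_map_eq_shiftHom_mul h hT hT' g hg e (hmin _ (Finset.mem_product.1 hx).1) s

/-- Proposition: `x_μ φ_A = h · Γ_{μ_1}(x_{μ̃} φ_{Ã})`.
`A` a row-standard `μ`-tableau of type `λ`; `Ã` obtained by deleting row 1, of type
`λ̃`, a `μ̃ = (μ_2,μ_3,…)`-tableau over `H_{n-μ_1}`; `Γ_{μ_1} : H_{n-μ_1} → H_n` the
algebra map `T_i ↦ T_{i+μ_1}` (called `g` below).  There exists `h ∈ H_n`, depending
only on `μ, λ, λ̃`, with `x_μ φ_A = h * Γ_{μ_1}(x_{μ̃} φ_{Ã})` for every such `A`. -/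
theorem xphi_top_row_removal
    {F : Type*} [Field F] {H : Type*} [Ring H] [Algebra F H]
    {H' : Type*} [Ring H'] [Algebra F H']
    {n : ℕ} (q : F) (hq : q ≠ 0)
    (mu lam lamt : ℕ → ℕ) (hmu : IsPartition n mu) (hlam : IsComposition n lam)
    (hlamt : IsComposition (n - mu 0) lamt)
    (T : Equiv.Perm (Fin n) → H) (hT : IsHeckeBasis q T)
    (T' : Equiv.Perm (Fin (n - mu 0)) → H') (hT' : IsHeckeBasis q T')
    (g : H' →ₐ[F] H)
    (hg : ∀ (i : ℕ) (hi : i + 1 < n - mu 0),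
      g (T' (adjT i hi)) = T (adjT (i + mu 0) (by omega))) :
    ∃ h : H, ∀ (A : ℕ → Multiset ℕ) (d : Equiv.Perm (Fin n))
      (dt : Equiv.Perm (Fin (n - mu 0))),
      RowsOfShape mu A → HasType A lam → Is1A mu lam A d →
      HasType (fun s => A (s+1)) lamt →
      Is1A (fun s => mu (s+1)) lamt (fun s => A (s+1)) dt →
      XPhi T lam mu d = h * g (XPhi T' lamt (fun s => mu (s+1)) dt) := by
  have h : mu 0 + (n - mu 0) = n := Nat.add_sub_cancel' hmu.1.apply_zero_le
  exact ⟨∑ e ∈ topReps h lam lamt, T e, fun _ _ _ _ _ hd _ hdt =>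
    xPhi_eq_sum_topReps_mul h hmu.1 hlam hlamt hT hT' g hg hd hdt⟩

end FayersSemistd
end
end

section
/- Let μ be a skew partition of n > 0, and let ν be the skew partition obtained by removing the first (leftmost) node from the first nonempty row of the diagram of μ; ν is a skew partition of n − 1. Then T_{w_μ} y_{μ′} ∈ Γ_1(T_{w_ν} y_{ν′}) H_n, where T_{w_ν} y_{ν′} is computed in H_{n−1}. -/
open scoped Classical

noncomputable section

namespace FayersSemistd

/-- Row lengths of the skew diagram `μ/λ`. -/
def skewRL (outer inner : ℕ → ℕ) : ℕ → ℕ := fun r => outer r - inner r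

/-- The row of the `p`-th cell (in row-reading order) of the skew diagram. -/
def skewRow (outer inner : ℕ → ℕ) (p : ℕ) : ℕ := rowOf (skewRL outer inner) p

/-- The column of the `p`-th cell (in row-reading order) of the skew diagram. -/
def skewCol (outer inner : ℕ → ℕ) (p : ℕ) : ℕ :=
  inner (skewRow outer inner p) +
    (p - cumSum (skewRL outer inner) (skewRow outer inner p))

/-- `w = w_{μ/λ}`, i.e. `t^{μ/λ} w = t_{μ/λ}`: the image of cell `p` is the number of
cells coming strictly before `p` in column-reading order. -/
def IsWskew {n : ℕ} (outer inner : ℕ → ℕ) (w : Equiv.Perm (Fin n)) : Prop :=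
  ∀ p : Fin n, ((w p : Fin n) : ℕ) = (Finset.univ.filter (fun p' : Fin n =>
    skewCol outer inner (p' : ℕ) < skewCol outer inner (p : ℕ) ∨
      (skewCol outer inner (p' : ℕ) = skewCol outer inner (p : ℕ) ∧
        skewRow outer inner (p' : ℕ) < skewRow outer inner (p : ℕ)))).card

/-- `W(k)`: the permutations of the set of entries in column `k` of `t_{μ/λ}`
(fixing everything else), where `w = w_{μ/λ}`. -/
def colGroup {n : ℕ} (outer inner : ℕ → ℕ) (w : Equiv.Perm (Fin n)) (k : ℕ) :
    Set (Equiv.Perm (Fin n)) :=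
  {u | ∀ x : Fin n, (¬ ∃ p : Fin n, skewCol outer inner (p : ℕ) = k ∧ w p = x) →
    u x = x}

/-- `y_{(μ/λ)'} = ∏_k y_k`, `y_k = ∑_{u ∈ W(k)} (-q)^{-l(u)} T_u` (the factors
commute; `N` is any bound exceeding all column indices, factors for empty columns
being `1`). -/
def ySkew {F : Type*} [Field F] {H : Type*} [Ring H] [Algebra F H] {n : ℕ}
    (q : F) (T : Equiv.Perm (Fin n) → H) (outer inner : ℕ → ℕ)
    (w : Equiv.Perm (Fin n)) (N : ℕ) : H :=
  ((List.range N).map (fun k =>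
    ∑ u ∈ Finset.univ.filter (· ∈ colGroup outer inner w k),
      ((-q)⁻¹) ^ permLength u • T u)).prod

section Auxiliary

open Equiv

/-- The permutations that fix every point outside the fibre of `γ` over `k`. -/
def FiberPerm {n : ℕ} (γ : Fin n → ℕ) (k : ℕ) (u : Perm (Fin n)) : Prop :=
  ∀ x, γ x ≠ k → u x = x

/-- A function on `S_n` multiplicative along increasing multiplication by adjacent
transpositions. -/
structure IsReducedMul {H : Type*} [Ring H] {n : ℕ} (U : Perm (Fin n) → H) : Prop where
  one : U 1 = 1
  mul_swap : ∀ (w : Perm (Fin n)) (i j x y : Fin n), (i : ℕ) + 1 = j → w x = i → w y = j →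
    x < y → U w * U (swap i j) = U (swap i j * w)

theorem permLength_swap_mul {n : ℕ} (w : Perm (Fin n)) {i j x y : Fin n}
    (hij : (i : ℕ) + 1 = j) (hx : w x = i) (hy : w y = j) (hxy : x < y) :
    permLength (swap i j * w) = permLength w + 1 := by
  classical
  have hne : i ≠ j := by rintro rfl; omega
  have key : (Finset.univ.filter (fun p : Fin n × Fin n =>
      p.1 < p.2 ∧ (swap i j * w) p.2 < (swap i j * w) p.1)) =
      insert (x, y) (Finset.univ.filter (fun p : Fin n × Fin n =>
        p.1 < p.2 ∧ w p.2 < w p.1)) := by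
    ext ⟨s, t⟩
    rw [Finset.mem_filter, Finset.mem_insert, Finset.mem_filter, Prod.mk.injEq,
      Perm.mul_apply, Perm.mul_apply]
    simp only [Finset.mem_univ, true_and]
    have e1 : s = x ↔ w s = i := by rw [← hx, w.injective.eq_iff]
    have e2 : t = y ↔ w t = j := by rw [← hy, w.injective.eq_iff]
    have e3 : s = y ↔ w s = j := by rw [← hy, w.injective.eq_iff]
    have e4 : t = x ↔ w t = i := by rw [← hx, w.injective.eq_iff]
    have e5 : s = t ↔ w s = w t := w.injective.eq_iff.symm
    simp only [swap_apply_def]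
    simp only [Fin.ext_iff, Fin.lt_def] at *
    split_ifs <;> omega
  unfold permLength
  rw [key, Finset.card_insert_of_notMem]
  simp only [Finset.mem_filter, Finset.mem_univ, true_and, hx, hy, Fin.lt_def]
  omega

theorem permLength_one (n : ℕ) : permLength (1 : Perm (Fin n)) = 0 := by
  rw [permLength, Finset.card_eq_zero, Finset.filter_eq_empty_iff]
  rintro ⟨x, y⟩ - ⟨h, h'⟩
  exact lt_asymm h h'

theorem permLength_swap {n : ℕ} {i j : Fin n} (hij : (i : ℕ) + 1 = j) :
    permLength (swap i j) = 1 := by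
  have h := permLength_swap_mul 1 hij rfl rfl (by rw [Fin.lt_def]; omega)
  rwa [mul_one, permLength_one] at h

theorem exists_descent {n : ℕ} {u : Perm (Fin n)} (hu : u ≠ 1) :
    ∃ i j x y : Fin n, (i : ℕ) + 1 = j ∧ u x = i ∧ u y = j ∧ y < x := by
  by_contra! hcon
  apply hu
  cases n with
  | zero => exact Subsingleton.elim _ _
  | succ m =>
    have hmono : StrictMono u.symm := by
      rw [Fin.strictMono_iff_lt_succ]
      intro i
      refine lt_of_le_of_ne (hcon i.castSucc i.succ _ _ (by simp) (by simp) (by simp)) ?_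
      intro h
      have := u.symm.injective h
      simp [Fin.ext_iff] at this
    have h2 : StrictMono.orderIsoOfSurjective u.symm hmono u.symm.surjective =
      OrderIso.refl _ := Subsingleton.elim _ _
    ext x
    have h3 : u.symm (u x) = u x := DFunLike.congr_fun h2 (u x)
    rw [symm_apply_apply] at h3
    simp [← h3]

namespace FiberPerm

variable {n : ℕ} {γ : Fin n → ℕ} {k : ℕ} {u : Perm (Fin n)}

theorem map_fiber (hu : FiberPerm γ k u) (x : Fin n) : γ (u x) = γ x := by
  by_cases hx : γ x = k
  · by_contra h
    have h1 := hu (u x) (by rwa [hx] at h)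
    exact h (congrArg γ (u.injective h1))
  · rw [hu x hx]

theorem swap_mul (hu : FiberPerm γ k u) {i j : Fin n} (hi : γ i = k) (hj : γ j = k) :
    FiberPerm γ k (swap i j * u) := by
  intro x hx
  rw [Perm.mul_apply, hu x hx, swap_apply_of_ne_of_ne]
  · rintro rfl; exact hx hi
  · rintro rfl; exact hx hj

/-- The permutations supported on an interval are built from the identity by increasing
multiplications by adjacent transpositions of that interval. -/
theorem induction_on (hγ : Monotone γ) {P : Perm (Fin n) → Prop} (one : P 1)
    (step : ∀ (w : Perm (Fin n)) (i j x y : Fin n), (i : ℕ) + 1 = j → γ i = k → γ j = k →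
      w x = i → w y = j → x < y → P w → P (swap i j * w))
    (u : Perm (Fin n)) (hu : FiberPerm γ k u) : P u := by
  induction hl : permLength u using Nat.strong_induction_on generalizing u with
  | _ l ih =>
    by_cases h1 : u = 1
    · rwa [h1]
    obtain ⟨i, j, x, y, hij, hx, hy, hyx⟩ := exists_descent h1
    have hγij : γ i = γ j := by
      apply le_antisymm
      · exact hγ (by rw [Fin.le_def]; omega)
      · rw [← hx, ← hy, hu.map_fiber, hu.map_fiber]
        exact hγ hyx.le
    have hi : γ i = k := by
      by_contra h
      have e1 : x = i := u.injective (by rw [hx, hu i h])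
      have e2 : y = j := u.injective (by rw [hy, hu j (hγij ▸ h)])
      subst e1 e2
      rw [Fin.lt_def] at hyx
      omega
    have hj : γ j = k := hγij ▸ hi
    have hw : u = swap i j * (swap i j * u) := by rw [← mul_assoc, swap_mul_self, one_mul]
    have hwx : (swap i j * u) y = i := by simp [hy]
    have hwy : (swap i j * u) x = j := by simp [hx]
    have hlen := permLength_swap_mul _ hij hwx hwy hyx
    rw [← hw] at hlen
    rw [hw]
    exact step _ i j y x hij hi hj hwx hwy hyx
      (ih _ (by omega) _ (hu.swap_mul hi hj) rfl)

end FiberPerm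

section ExtendPerm

variable {m : ℕ}

/-- Extension of a permutation of `Fin m` to `Fin (m + 1)` fixing `a`. -/
def extendPerm (a : Fin (m + 1)) (u : Perm (Fin m)) : Perm (Fin (m + 1)) :=
  u.viaEmbedding a.succAboveEmb

@[simp] theorem extendPerm_self (a : Fin (m + 1)) (u : Perm (Fin m)) :
    extendPerm a u a = a :=
  Perm.viaEmbedding_apply_of_notMem _ _ _ (by simp)

@[simp] theorem extendPerm_succAbove (a : Fin (m + 1)) (u : Perm (Fin m)) (y : Fin m) :
    extendPerm a u (a.succAbove y) = a.succAbove (u y) :=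
  Perm.viaEmbedding_apply u a.succAboveEmb y

theorem perm_ext_succAbove (a : Fin (m + 1)) {f g : Perm (Fin (m + 1))} (h : f a = g a)
    (h' : ∀ y, f (a.succAbove y) = g (a.succAbove y)) : f = g := by
  ext1 x
  obtain rfl | ⟨y, rfl⟩ := Fin.eq_self_or_eq_succAbove a x
  · exact h
  · exact h' y

theorem extendPerm_one (a : Fin (m + 1)) : extendPerm a (1 : Perm (Fin m)) = 1 :=
  perm_ext_succAbove a (by simp) (by simp)

theorem extendPerm_swap_mul (a : Fin (m + 1)) (i j : Fin m) (u : Perm (Fin m)) :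
    extendPerm a (swap i j * u) =
      swap (a.succAbove i) (a.succAbove j) * extendPerm a u := by
  apply perm_ext_succAbove a
  · rw [extendPerm_self, Perm.mul_apply, extendPerm_self, swap_apply_of_ne_of_ne]
    · exact (Fin.succAbove_ne a i).symm
    · exact (Fin.succAbove_ne a j).symm
  · intro y
    rw [extendPerm_succAbove, Perm.mul_apply, Perm.mul_apply, extendPerm_succAbove,
      (Fin.succAbove_right_injective (p := a)).swap_apply]

theorem extendPerm_injective (a : Fin (m + 1)) :
    Function.Injective (extendPerm a : Perm (Fin m) → _) := by
  intro u v h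
  ext1 y
  apply Fin.succAbove_right_injective (p := a)
  rw [← extendPerm_succAbove, ← extendPerm_succAbove, h]

theorem exists_extendPerm (a : Fin (m + 1)) (v : Perm (Fin (m + 1))) (hv : v a = a) :
    ∃ u, extendPerm a u = v := by
  have hne : ∀ y, v (a.succAbove y) ≠ a := fun y h =>
    Fin.succAbove_ne a y (v.injective (h.trans hv.symm))
  choose f hf using fun y => Fin.exists_succAbove_eq (hne y)
  have hinj : Function.Injective f := by
    intro y z h
    apply Fin.succAbove_right_injective (p := a)
    apply v.injective
    rw [← hf, ← hf, h]
  refine ⟨Equiv.ofBijective f (Finite.injective_iff_bijective.mp hinj), ?_⟩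
  apply perm_ext_succAbove a
  · rw [extendPerm_self, hv]
  · intro y
    rw [extendPerm_succAbove, Equiv.ofBijective_apply, hf]

/-- The cycle sending `0` to `a` and `j` to `j - 1` for `1 ≤ j ≤ a`. -/
def zeroCycle (a : Fin (m + 1)) : Perm (Fin (m + 1)) := a.cycleRange.symm

@[simp] theorem zeroCycle_zero (a : Fin (m + 1)) : zeroCycle a 0 = a :=
  Fin.cycleRange_symm_zero a

@[simp] theorem zeroCycle_succ (a : Fin (m + 1)) (y : Fin m) :
    zeroCycle a y.succ = a.succAbove y :=
  Fin.cycleRange_symm_succ a y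

theorem perm_ext_succ {f g : Perm (Fin (m + 1))} (h : f 0 = g 0)
    (h' : ∀ y : Fin m, f y.succ = g y.succ) : f = g :=
  perm_ext_succAbove 0 h (by simpa using h')

@[simp] theorem extendPerm_zero_succ (u : Perm (Fin m)) (y : Fin m) :
    extendPerm 0 u y.succ = (u y).succ := by
  simpa using extendPerm_succAbove 0 u y

theorem zeroCycle_mul_extendPerm (a : Fin (m + 1)) (u : Perm (Fin m)) :
    zeroCycle a * extendPerm 0 u = extendPerm a u * zeroCycle a :=
  perm_ext_succ (by simp) (by simp)

theorem zeroCycle_succ_eq (a : Fin m) :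
    zeroCycle a.succ = swap a.castSucc a.succ * zeroCycle a.castSucc := by
  refine perm_ext_succ (by simp) fun y => ?_
  rw [zeroCycle_succ, Perm.mul_apply, zeroCycle_succ, swap_apply_def]
  simp only [Fin.succAbove, Fin.lt_def, Fin.ext_iff]
  split_ifs <;> simp_all <;> omega

variable {H : Type*} [Ring H] {U : Perm (Fin (m + 1)) → H}

theorem IsReducedMul.mul_zeroCycle (hU : IsReducedMul U) (u : Perm (Fin (m + 1)))
    (hu : u 0 = 0) (a : Fin (m + 1)) : U u * U (zeroCycle a) = U (zeroCycle a * u) := by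
  have h0 : zeroCycle (0 : Fin (m + 1)) = 1 := perm_ext_succ (by simp) (by simp)
  have step : ∀ (v : Perm (Fin (m + 1))) (a : Fin m), v 0 = 0 →
      U (zeroCycle a.castSucc * v) * U (swap a.castSucc a.succ) =
        U (zeroCycle a.succ * v) := by
    intro v a hv
    rw [zeroCycle_succ_eq, mul_assoc]
    refine hU.mul_swap _ _ _ 0 (v⁻¹ a.succ) (by simp) (by simp [hv]) (by simp) ?_
    rw [Fin.pos_iff_ne_zero]
    intro h
    rw [Perm.inv_eq_iff_eq, hv] at h
    exact Fin.succ_ne_zero a h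
  induction a using Fin.induction with
  | zero => rw [h0, hU.one, one_mul, mul_one]
  | succ a ih =>
    have h1 := step 1 a rfl
    rw [mul_one, mul_one] at h1
    rw [← h1, ← mul_assoc, ih, step u a hu]

theorem IsReducedMul.map_extendPerm_zero {F H' : Type*} [Field F] [Algebra F H] [Ring H']
    [Algebra F H'] (hU : IsReducedMul U) {U' : Perm (Fin m) → H'} (hU' : IsReducedMul U')
    (g : H' →ₐ[F] H)
    (hg : ∀ i j : Fin m, (i : ℕ) + 1 = j → g (U' (swap i j)) = U (swap i.succ j.succ))
    (u : Perm (Fin m)) : g (U' u) = U (extendPerm 0 u) := by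
  refine FiberPerm.induction_on (γ := fun _ => 0) (k := 0)
    (P := fun u => g (U' u) = U (extendPerm 0 u)) monotone_const ?_ ?_ u
    (fun x hx => absurd rfl hx)
  · rw [hU'.one, map_one, extendPerm_one, hU.one]
  · intro w i j x y hij _ _ hx hy hxy ih
    rw [← hU'.mul_swap w i j x y hij hx hy hxy, map_mul, ih, hg i j hij,
      extendPerm_swap_mul, Fin.succAbove_zero,
      ← hU.mul_swap _ i.succ j.succ x.succ y.succ (by simp [hij]) (by simp [hx])
        (by simp [hy]) (by simpa using hxy)]

theorem IsReducedMul.zeroCycle_mul (hU : IsReducedMul U) {γ : Fin (m + 1) → ℕ}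
    (hγ : Monotone γ) {a : Fin (m + 1)} (ha : ∀ x < a, γ x < γ a) (k : ℕ)
    (u : Perm (Fin m)) (hu : FiberPerm (fun y => γ (a.succAbove y)) k u) :
    U (zeroCycle a) * U (extendPerm a u) = U (extendPerm 0 u) * U (zeroCycle a) := by
  rw [hU.mul_zeroCycle _ (extendPerm_self 0 u), zeroCycle_mul_extendPerm]
  refine FiberPerm.induction_on (P := fun u => U (zeroCycle a) * U (extendPerm a u) =
      U (extendPerm a u * zeroCycle a))
    (hγ.comp (Fin.strictMono_succAbove a).monotone) ?_ ?_ u hu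
  · simp [extendPerm_one, hU.one]
  · intro w i j x y hij hi hj hx hy hxy ih
    have hij' : (a.succAbove i : ℕ) + 1 = a.succAbove j := by
      by_contra hne
      have h1 : i.castSucc < a ∧ (a : ℕ) ≤ j := by
        simp only [Fin.succAbove, Fin.lt_def] at hne ⊢
        split_ifs at hne <;> simp at * <;> omega
      have h2 : a.succAbove i = i.castSucc := Fin.succAbove_of_castSucc_lt _ _ h1.1
      have h3 : a ≤ a.succAbove j := by
        rw [Fin.succAbove_of_le_castSucc _ _ (by rw [Fin.le_def]; exact h1.2)]
        rw [Fin.le_def, Fin.val_succ]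
        omega
      have h4 := ha _ h1.1
      have h5 := hγ h3
      simp only [Function.comp_apply] at hi hj
      rw [h2] at hi
      omega
    have hlt : a.succAbove x < a.succAbove y := Fin.strictMono_succAbove a hxy
    rw [extendPerm_swap_mul,
      ← hU.mul_swap (extendPerm a w) _ _ (a.succAbove x) (a.succAbove y) hij'
        (by simp [hx]) (by simp [hy]) hlt, ← mul_assoc, ih, mul_assoc (swap _ _),
      hU.mul_swap (extendPerm a w * zeroCycle a) _ _ x.succ y.succ hij' (by simp [hx])
        (by simp [hy]) (by simpa using hxy)]

end ExtendPerm

section FiberSum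

variable {H : Type*} [Ring H] {n : ℕ}

/-- The sum of `U` over the permutations supported on the fibre of `γ` over `k`. -/
def fiberSum (U : Perm (Fin n) → H) (γ : Fin n → ℕ) (k : ℕ) : H :=
  ∑ u ∈ Finset.univ.filter (FiberPerm γ k), U u

/-- The part of `fiberSum` with `u a = b`. -/
def fiberSumAt (U : Perm (Fin n) → H) (γ : Fin n → ℕ) (k : ℕ) (a b : Fin n) : H :=
  ∑ u ∈ Finset.univ.filter (fun u => FiberPerm γ k u ∧ u a = b), U u

variable {U : Perm (Fin n) → H} {γ : Fin n → ℕ}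

theorem IsReducedMul.commute_swap_fiberSum (hU : IsReducedMul U) (hγ : Monotone γ)
    {k : ℕ} {i j : Fin n} (hij : (i : ℕ) + 1 = j) (hi : γ i ≠ k) (hj : γ j ≠ k) :
    Commute (U (swap i j)) (fiberSum U γ k) := by
  refine Commute.sum_right _ _ _ fun u hu => ?_
  refine FiberPerm.induction_on (k := k) (P := fun u => Commute (U (swap i j)) (U u)) hγ
    ?_ ?_ u (by simpa using hu)
  · rw [hU.one]; exact Commute.one_right _
  · intro w l l' x y hl hkl hkl' hx hy hxy ih
    rw [← hU.mul_swap w l l' x y hl hx hy hxy]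
    refine ih.mul_right ?_
    have h1 : swap i j l = l := swap_apply_of_ne_of_ne (by rintro rfl; exact hi hkl)
      (by rintro rfl; exact hj hkl)
    have h2 : swap i j l' = l' := swap_apply_of_ne_of_ne (by rintro rfl; exact hi hkl')
      (by rintro rfl; exact hj hkl')
    have h3 : swap l l' i = i := swap_apply_of_ne_of_ne (by rintro rfl; exact hi hkl)
      (by rintro rfl; exact hi hkl')
    have h4 : swap l l' j = j := swap_apply_of_ne_of_ne (by rintro rfl; exact hj hkl)
      (by rintro rfl; exact hj hkl')
    rw [Commute, SemiconjBy,
      hU.mul_swap _ l l' l l' hl h1 h2 (by rw [Fin.lt_def]; omega),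
      hU.mul_swap _ i j i j hij h3 h4 (by rw [Fin.lt_def]; omega),
      mul_swap_eq_swap_mul, h3, h4]

theorem fiberSumAt_eq_zero {k : ℕ} {a b : Fin n} (h : γ b ≠ γ a) :
    fiberSumAt U γ k a b = 0 := by
  unfold fiberSumAt
  rw [Finset.filter_false_of_mem, Finset.sum_empty]
  rintro u - ⟨hu, rfl⟩
  exact h (hu.map_fiber a)

theorem IsReducedMul.fiberSumAt_mul_swap (hU : IsReducedMul U) {a i j : Fin n}
    (ha : ∀ x < a, γ x < γ a) (hij : (i : ℕ) + 1 = j) (hi : γ i = γ a) (hj : γ j = γ a) :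
    fiberSumAt U γ (γ a) a i * U (swap i j) = fiberSumAt U γ (γ a) a j := by
  unfold fiberSumAt
  rw [Finset.sum_mul]
  refine Finset.sum_bij' (fun u _ => swap i j * u) (fun u _ => swap i j * u) ?_ ?_ ?_ ?_ ?_
  · intro u hu
    simp only [Finset.mem_filter, Finset.mem_univ, true_and] at hu ⊢
    exact ⟨hu.1.swap_mul hi hj, by simp [hu.2]⟩
  · intro u hu
    simp only [Finset.mem_filter, Finset.mem_univ, true_and] at hu ⊢
    exact ⟨hu.1.swap_mul hi hj, by simp [hu.2]⟩
  · intro u _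
    rw [← mul_assoc, swap_mul_self, one_mul]
  · intro u _
    rw [← mul_assoc, swap_mul_self, one_mul]
  · intro u hu
    simp only [Finset.mem_filter, Finset.mem_univ, true_and] at hu
    obtain ⟨hu, hua⟩ := hu
    refine hU.mul_swap u i j a (u⁻¹ j) hij hua (by simp) ?_
    have h1 : γ (u⁻¹ j) = γ a := by
      rw [← hu.map_fiber]
      simpa using hj
    have h2 : u⁻¹ j ≠ a := by
      intro h
      rw [Perm.inv_eq_iff_eq, hua] at h
      rw [h] at hij
      omega
    refine lt_of_le_of_ne (le_of_not_gt fun h => ?_) h2.symm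
    exact (ha _ h).ne h1

theorem IsReducedMul.exists_fiberSumAt_eq_mul (hU : IsReducedMul U) (hγ : Monotone γ)
    {a : Fin n} (ha : ∀ x < a, γ x < γ a) (b : ℕ) (hb : b < n) :
    ∃ X : H, (∀ k ≠ γ a, Commute X (fiberSum U γ k)) ∧
      fiberSumAt U γ (γ a) a ⟨b, hb⟩ = fiberSumAt U γ (γ a) a a * X := by
  induction b with
  | zero =>
    by_cases h0 : (⟨0, hb⟩ : Fin n) = a
    · exact ⟨1, fun _ _ => Commute.one_left _, by rw [h0, mul_one]⟩
    · refine ⟨0, fun _ _ => Commute.zero_left _, ?_⟩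
      rw [mul_zero, fiberSumAt_eq_zero]
      refine (ha _ (lt_of_le_of_ne ?_ h0)).ne
      exact Nat.zero_le _
  | succ b ih =>
    by_cases hγb : γ ⟨b + 1, hb⟩ = γ a
    · by_cases hba : (⟨b + 1, hb⟩ : Fin n) = a
      · exact ⟨1, fun _ _ => Commute.one_left _, by rw [hba, mul_one]⟩
      · have hle : a ≤ ⟨b + 1, hb⟩ := le_of_not_gt fun h => (ha _ h).ne hγb
        have hlt : a < ⟨b + 1, hb⟩ := lt_of_le_of_ne hle (Ne.symm hba)
        have hγb' : γ ⟨b, by omega⟩ = γ a := by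
          apply le_antisymm
          · rw [← hγb]
            exact hγ (by simp [Fin.le_def])
          · exact hγ (by rw [Fin.lt_def] at hlt; rw [Fin.le_def]; exact Nat.le_of_lt_succ hlt)
        obtain ⟨X, hX, hX'⟩ := ih (by omega)
        refine ⟨X * U (swap ⟨b, by omega⟩ ⟨b + 1, hb⟩), fun k hk => ?_, ?_⟩
        · exact (hX k hk).mul_left (hU.commute_swap_fiberSum hγ rfl (hγb' ▸ hk.symm)
            (hγb ▸ hk.symm))
        · rw [← mul_assoc, ← hX', hU.fiberSumAt_mul_swap ha rfl hγb' hγb]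
    · refine ⟨0, fun _ _ => Commute.zero_left _, ?_⟩
      rw [mul_zero, fiberSumAt_eq_zero hγb]

theorem IsReducedMul.exists_fiberSum_eq_mul (hU : IsReducedMul U) (hγ : Monotone γ)
    {a : Fin n} (ha : ∀ x < a, γ x < γ a) (k : ℕ) :
    ∃ X : H, (∀ j ≠ k, Commute X (fiberSum U γ j)) ∧
      fiberSum U γ k = fiberSumAt U γ k a a * X := by
  by_cases hk : k = γ a
  · subst hk
    choose X hX hX' using fun b : Fin n => hU.exists_fiberSumAt_eq_mul hγ ha b b.2
    refine ⟨∑ b, X b, fun j hj => Commute.sum_left _ _ _ fun b _ => hX b j hj, ?_⟩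
    rw [Finset.mul_sum, fiberSum, ← Finset.sum_fiberwise _ (fun u : Perm (Fin n) => u a)]
    refine Finset.sum_congr rfl fun b _ => ?_
    rw [← hX' b, Finset.filter_filter]
    rfl
  · refine ⟨1, fun _ _ => Commute.one_left _, ?_⟩
    rw [mul_one]
    refine Finset.sum_congr (Finset.filter_congr fun u _ => ?_) fun _ _ => rfl
    exact ⟨fun hu => ⟨hu, hu a (Ne.symm hk)⟩, fun hu => hu.1⟩

end FiberSum

section NodeRemoval

variable {F H H' : Type*} [Field F] [Ring H] [Algebra F H] [Ring H'] [Algebra F H'] {m : ℕ}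
  {U : Perm (Fin (m + 1)) → H} {U' : Perm (Fin m) → H'} {γ : Fin (m + 1) → ℕ}
  {a : Fin (m + 1)}

theorem fiberSumAt_self_eq_sum (k : ℕ) :
    fiberSumAt U γ k a a = ∑ u ∈ Finset.univ.filter
      (FiberPerm (fun y => γ (a.succAbove y)) k), U (extendPerm a u) := by
  symm
  refine Finset.sum_bij (fun u _ => extendPerm a u) ?_
    (fun _ _ _ _ h => extendPerm_injective a h) ?_ (fun _ _ => rfl)
  · intro u hu
    simp only [Finset.mem_filter, Finset.mem_univ, true_and] at hu ⊢
    refine ⟨fun x hx => ?_, extendPerm_self a u⟩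
    obtain rfl | ⟨y, rfl⟩ := Fin.eq_self_or_eq_succAbove a x
    · exact extendPerm_self x u
    · rw [extendPerm_succAbove, hu y hx]
  · intro v hv
    simp only [Finset.mem_filter, Finset.mem_univ, true_and] at hv
    obtain ⟨u, rfl⟩ := exists_extendPerm a v hv.2
    refine ⟨u, ?_, rfl⟩
    simp only [Finset.mem_filter, Finset.mem_univ, true_and]
    intro y hy
    apply Fin.succAbove_right_injective (p := a)
    rw [← extendPerm_succAbove, hv.1 _ hy]

theorem IsReducedMul.exists_zeroCycle_mul_prod (hU : IsReducedMul U)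
    (hU' : IsReducedMul U') (hγ : Monotone γ) (ha : ∀ x < a, γ x < γ a) (g : H' →ₐ[F] H)
    (hg : ∀ i j : Fin m, (i : ℕ) + 1 = j → g (U' (swap i j)) = U (swap i.succ j.succ))
    (N : ℕ) :
    ∃ X : H, (∀ j, N ≤ j → Commute X (fiberSum U γ j)) ∧
      U (zeroCycle a) * ((List.range N).map (fiberSum U γ)).prod =
        g ((List.range N).map (fiberSum U' fun y => γ (a.succAbove y))).prod *
          (U (zeroCycle a) * X) := by
  induction N with
  | zero => exact ⟨1, fun _ _ => Commute.one_left _, by simp⟩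
  | succ N ih =>
    obtain ⟨X, hX, hX'⟩ := ih
    obtain ⟨Z, hZ, hZ'⟩ := hU.exists_fiberSum_eq_mul hγ ha N
    have hN : U (zeroCycle a) * fiberSumAt U γ N a a =
        g (fiberSum U' (fun y => γ (a.succAbove y)) N) * U (zeroCycle a) := by
      rw [fiberSumAt_self_eq_sum, fiberSum, map_sum, Finset.mul_sum, Finset.sum_mul]
      refine Finset.sum_congr rfl fun u hu => ?_
      rw [hU.map_extendPerm_zero hU' g hg]
      exact hU.zeroCycle_mul hγ ha N u (by simpa using hu)
    refine ⟨Z * X, fun j hj => (hZ j (by omega)).mul_left (hX j (by omega)), ?_⟩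
    simp only [List.range_succ, List.map_append, List.prod_append, List.map_cons,
      List.map_nil, List.prod_singleton, map_mul]
    rw [← mul_assoc, hX', mul_assoc, mul_assoc, (hX N le_rfl).eq, hZ',
      mul_assoc (fiberSumAt U γ N a a), ← mul_assoc (U (zeroCycle a)), hN]
    simp only [mul_assoc]

end NodeRemoval

theorem IsHeckeBasis.isReducedMul {F H : Type*} [Field F] [Ring H] [Algebra F H] {n : ℕ}
    {q : F} {T : Perm (Fin n) → H} (hT : IsHeckeBasis q T) (c : F) :
    IsReducedMul fun w => c ^ permLength w • T w := by
  refine ⟨by simp [permLength_one, hT.one], ?_⟩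
  intro w i j x y hij hx hy hxy
  obtain ⟨i, hi⟩ := i
  obtain ⟨j, hj⟩ := j
  obtain rfl : i + 1 = j := hij
  have e1 := permLength_swap_mul w rfl hx hy hxy
  have e2 := permLength_swap (i := (⟨i, hi⟩ : Fin n)) (j := ⟨i + 1, hj⟩) rfl
  have e3 := hT.mul_adj_asc w i hj (by unfold adjT; omega)
  unfold adjT at e3
  rw [smul_mul_smul_comm, e3, e1, e2, pow_one, pow_succ]

section SkewShape

/-- The column of the cell labelled `x` when cells are labelled through `w`. -/
def labelCol {n : ℕ} (outer inner : ℕ → ℕ) (w : Perm (Fin n)) (x : Fin n) : ℕ :=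
  skewCol outer inner (w.symm x : ℕ)

theorem ySkew_eq_prod_fiberSum {F H : Type*} [Field F] [Ring H] [Algebra F H] {n : ℕ}
    (q : F) (T : Perm (Fin n) → H) (outer inner : ℕ → ℕ) (w : Perm (Fin n)) (N : ℕ) :
    ySkew q T outer inner w N = ((List.range N).map
      (fiberSum (fun u => ((-q)⁻¹) ^ permLength u • T u) (labelCol outer inner w))).prod := by
  unfold ySkew
  congr 2
  funext k
  refine Finset.sum_congr (Finset.filter_congr fun u _ => ?_) fun _ _ => rfl
  refine forall_congr' fun x => imp_congr (not_congr ?_) Iff.rfl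
  constructor
  · rintro ⟨p, hp, rfl⟩
    simpa [labelCol] using hp
  · intro h
    exact ⟨w.symm x, h, by simp⟩

variable {n : ℕ} {outer inner : ℕ → ℕ} {w : Perm (Fin n)}

/-- The column-reading order on the cells of a skew diagram. -/
def ColBefore (outer inner : ℕ → ℕ) (p p' : ℕ) : Prop :=
  skewCol outer inner p < skewCol outer inner p' ∨
    (skewCol outer inner p = skewCol outer inner p' ∧
      skewRow outer inner p < skewRow outer inner p')

theorem IsWskew.lt_iff (hw : IsWskew outer inner w) (p p' : Fin n) :
    w p < w p' ↔ ColBefore outer inner p p' := by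
  have hle : ∀ s t : Fin n, ¬ ColBefore outer inner t s → w s ≤ w t := by
    intro s t hst
    rw [Fin.le_def, hw s, hw t]
    refine Finset.card_le_card (Finset.monotone_filter_right _ fun x _ hx => ?_)
    unfold ColBefore at hst
    omega
  constructor
  · intro h
    by_contra hcon
    exact absurd h (not_lt.mpr (hle _ _ hcon))
  · intro h
    refine lt_of_le_of_ne (hle _ _ (by unfold ColBefore at h ⊢; omega)) fun heq => ?_
    rw [w.injective heq] at h
    unfold ColBefore at h
    omega

theorem IsWskew.monotone_labelCol (hw : IsWskew outer inner w) :
    Monotone (labelCol outer inner w) := by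
  intro x y hxy
  by_contra! h
  have := (hw.lt_iff (w.symm y) (w.symm x)).mpr (Or.inl h)
  simp only [apply_symm_apply] at this
  exact absurd this (not_lt.mpr hxy)

theorem rowOf_zero_le (f : ℕ → ℕ) {N p : ℕ} (hp : p < cumSum f N) :
    rowOf f 0 ≤ rowOf f p := by
  have hne : {r | p < cumSum f (r + 1)}.Nonempty := by
    cases N with
    | zero => simp [cumSum] at hp
    | succ N => exact ⟨N, hp⟩
  exact Nat.sInf_le (lt_of_le_of_lt (Nat.zero_le p) (Nat.sInf_mem hne))

theorem IsWskew.labelCol_lt {m : ℕ} {w : Perm (Fin (m + 1))} (hw : IsWskew outer inner w)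
    (hsize : IsComposition (m + 1) (skewRL outer inner)) (x : Fin (m + 1)) (hx : x < w 0) :
    labelCol outer inner w x < labelCol outer inner w (w 0) := by
  have h := (hw.lt_iff (w.symm x) 0).mp (by simpa using hx)
  obtain ⟨N, -, hN⟩ := hsize
  have hrow := rowOf_zero_le (skewRL outer inner) (N := N)
    (lt_of_lt_of_eq (w.symm x).2 hN.symm)
  simp only [labelCol, symm_apply_apply]
  rcases h with h | ⟨-, h⟩
  · exact h
  · exact absurd h (not_lt.mpr hrow)

variable {mu lam : ℕ → ℕ} {r0 : ℕ}

theorem cumSum_skewRL_of_le (hr0' : ∀ s, s < r0 → mu s = lam s) {r : ℕ} (hr : r ≤ r0) :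
    cumSum (skewRL mu lam) r = 0 := by
  refine Finset.sum_eq_zero fun s hs => ?_
  rw [Finset.mem_range] at hs
  simp [skewRL, hr0' s (by omega)]

theorem cumSum_skewRL_update (hr0 : lam r0 < mu r0) {r : ℕ} (hr : r0 < r) :
    cumSum (skewRL mu lam) r =
      cumSum (skewRL mu (Function.update lam r0 (lam r0 + 1))) r + 1 := by
  have hmem : r0 ∈ Finset.range r := Finset.mem_range.mpr hr
  have hrest : ∀ s ∈ (Finset.range r).erase r0, skewRL mu lam s =
      skewRL mu (Function.update lam r0 (lam r0 + 1)) s := by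
    intro s hs
    simp [skewRL, Function.update_of_ne (Finset.ne_of_mem_erase hs)]
  have hself : skewRL mu lam r0 =
      skewRL mu (Function.update lam r0 (lam r0 + 1)) r0 + 1 := by
    simp only [skewRL, Function.update_self]
    omega
  unfold cumSum
  rw [← Finset.add_sum_erase _ (skewRL mu lam) hmem, Finset.sum_congr rfl hrest, hself,
    ← Finset.add_sum_erase _ _ hmem]
  exact add_right_comm _ _ _

theorem update_eq_of_lt (hr0' : ∀ s, s < r0 → mu s = lam s) (s : ℕ) (hs : s < r0) :
    mu s = Function.update lam r0 (lam r0 + 1) s := by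
  rw [Function.update_of_ne hs.ne, hr0' s hs]

theorem skewRow_update (hr0 : lam r0 < mu r0) (hr0' : ∀ s, s < r0 → mu s = lam s) (p : ℕ) :
    skewRow mu (Function.update lam r0 (lam r0 + 1)) p = skewRow mu lam (p + 1) := by
  unfold skewRow rowOf
  congr 1
  ext r
  simp only [Set.mem_ofPred_eq]
  by_cases hr : r0 < r + 1
  · rw [cumSum_skewRL_update hr0 hr]
    omega
  · rw [cumSum_skewRL_of_le hr0' (by omega),
      cumSum_skewRL_of_le (update_eq_of_lt hr0') (by omega)]
    omega

theorem skewCol_update (hr0 : lam r0 < mu r0) (hr0' : ∀ s, s < r0 → mu s = lam s)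
    {N p : ℕ} (hp : p + 1 < cumSum (skewRL mu lam) N) :
    skewCol mu (Function.update lam r0 (lam r0 + 1)) p = skewCol mu lam (p + 1) := by
  have hne : {r | p + 1 < cumSum (skewRL mu lam) (r + 1)}.Nonempty := by
    cases N with
    | zero => simp [cumSum] at hp
    | succ N => exact ⟨N, hp⟩
  have hmem : p + 1 < cumSum (skewRL mu lam) (skewRow mu lam (p + 1) + 1) :=
    Nat.sInf_mem hne
  unfold skewCol
  rw [skewRow_update hr0 hr0']
  set r := skewRow mu lam (p + 1)
  rcases lt_trichotomy r r0 with hr | hr | hr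
  · rw [cumSum_skewRL_of_le hr0' (by omega)] at hmem
    omega
  · rw [hr, cumSum_skewRL_of_le hr0' le_rfl,
      cumSum_skewRL_of_le (update_eq_of_lt hr0') le_rfl, Function.update_self]
    omega
  · rw [cumSum_skewRL_update hr0 hr, Function.update_of_ne hr.ne']
    omega

theorem IsWskew.eq_zeroCycle_mul {m : ℕ} {outer' inner' : ℕ → ℕ} {w : Perm (Fin (m + 1))}
    {w' : Perm (Fin m)} (hw : IsWskew outer inner w) (hw' : IsWskew outer' inner' w')
    (hcol : ∀ p : Fin m, skewCol outer' inner' p = skewCol outer inner (p + 1))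
    (hrow : ∀ p : Fin m, skewRow outer' inner' p = skewRow outer inner (p + 1)) :
    w = zeroCycle (w 0) * extendPerm 0 w' := by
  refine perm_ext_succ (by simp) fun p => ?_
  rw [Perm.mul_apply, extendPerm_zero_succ, zeroCycle_succ]
  have h1 := hw p.succ
  rw [Fin.card_filter_univ_succ] at h1
  have h2 := hw' p
  simp only [hcol, hrow] at h2
  simp only [Fin.val_succ] at h1
  rw [← h2] at h1
  by_cases hlt : ColBefore outer inner (0 : Fin (m + 1)) p.succ
  · have h3 := (hw.lt_iff 0 p.succ).mpr hlt
    unfold ColBefore at hlt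
    rw [Fin.val_succ] at hlt
    rw [if_pos hlt] at h1
    rw [Fin.lt_def] at h3
    rw [Fin.succAbove_of_le_castSucc _ _ (by rw [Fin.le_def, Fin.val_castSucc]; omega),
      Fin.ext_iff, Fin.val_succ, h1]
  · have h3 : w p.succ < w 0 := lt_of_le_of_ne
      (not_lt.mp fun h => hlt ((hw.lt_iff 0 p.succ).mp h))
      fun h => Fin.succ_ne_zero p (w.injective h)
    unfold ColBefore at hlt
    rw [Fin.val_succ] at hlt
    rw [if_neg hlt] at h1
    rw [Fin.lt_def] at h3
    rw [Fin.succAbove_of_castSucc_lt _ _ (by rw [Fin.lt_def, Fin.val_castSucc]; omega),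
      Fin.ext_iff, Fin.val_castSucc, h1]

end SkewShape

end Auxiliary

/-- Lemma: removing the first node of the first nonempty row of a
skew partition.  `μ/λ` a skew partition of `n > 0`; `ν = μ/λ'` where `λ'` adds one
node to row `r₀`, the first nonempty row; `Γ_1 : H_{n-1} → H_n` is `T_i ↦ T_{i+1}`
(called `g`).  Then `T_{w_{μ/λ}} y_{(μ/λ)'} ∈ Γ_1(T_{w_ν} y_{ν'}) H_n`. -/
theorem twy_skew_node_removal
    {F : Type*} [Field F] {H : Type*} [Ring H] [Algebra F H]
    {H' : Type*} [Ring H'] [Algebra F H']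
    {n : ℕ} (hn : 0 < n) (q : F) (hq : q ≠ 0)
    (mu lam : ℕ → ℕ) (hmu : Antitone mu) (hlam : Antitone lam)
    (hsub : ∀ s, lam s ≤ mu s) (hsize : IsComposition n (skewRL mu lam))
    (r0 : ℕ) (hr0 : lam r0 < mu r0) (hr0' : ∀ s, s < r0 → mu s = lam s)
    (T : Equiv.Perm (Fin n) → H) (hT : IsHeckeBasis q T)
    (T' : Equiv.Perm (Fin (n - 1)) → H') (hT' : IsHeckeBasis q T')
    (g : H' →ₐ[F] H)
    (hg : ∀ (i : ℕ) (hi : i + 1 < n - 1),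
      g (T' (adjT i hi)) = T (adjT (i + 1) (by omega)))
    (wsk : Equiv.Perm (Fin n)) (hwsk : IsWskew mu lam wsk)
    (wnu : Equiv.Perm (Fin (n - 1)))
    (hwnu : IsWskew mu (Function.update lam r0 (lam r0 + 1)) wnu)
    (N : ℕ) (hN : ∀ p : Fin n, skewCol mu lam (p : ℕ) < N)
    (hN' : ∀ p : Fin (n - 1),
      skewCol mu (Function.update lam r0 (lam r0 + 1)) (p : ℕ) < N) :
    ∃ h : H, T wsk * ySkew q T mu lam wsk N
      = g (T' wnu * ySkew q T' mu (Function.update lam r0 (lam r0 + 1)) wnu N) * h := by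
  obtain ⟨m, rfl⟩ : ∃ m, n = m + 1 := ⟨n - 1, by omega⟩
  change Equiv.Perm (Fin m) → H' at T'
  change Equiv.Perm (Fin m) at wnu
  have hc : (-q)⁻¹ ≠ 0 := inv_ne_zero (neg_ne_zero.mpr hq)
  set U : Equiv.Perm (Fin (m + 1)) → H := fun w => ((-q)⁻¹) ^ permLength w • T w with hUdef
  set U' : Equiv.Perm (Fin m) → H' := fun w => ((-q)⁻¹) ^ permLength w • T' w with hU'def
  have hU : IsReducedMul U := hT.isReducedMul _
  have hU' : IsReducedMul U' := hT'.isReducedMul _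
  have hTU : T wsk = (((-q)⁻¹) ^ permLength wsk)⁻¹ • U wsk := by
    rw [hUdef, inv_smul_smul₀ (pow_ne_zero _ hc)]
  have hgU : ∀ i j : Fin m, (i : ℕ) + 1 = j →
      g (U' (Equiv.swap i j)) = U (Equiv.swap i.succ j.succ) := by
    rintro ⟨i, hi⟩ ⟨j, hj⟩ hij
    obtain rfl : i + 1 = j := hij
    simp only [hUdef, hU'def, map_smul]
    rw [permLength_swap (i := (⟨i, hi⟩ : Fin m)) (j := ⟨i + 1, hj⟩) rfl,
      permLength_swap (by simp)]
    exact congrArg _ (hg i hj)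
  obtain ⟨Ns, hNs, hsum⟩ := id hsize
  have hcol : ∀ p : Fin m, skewCol mu (Function.update lam r0 (lam r0 + 1)) p =
      skewCol mu lam (p + 1) := fun p =>
    skewCol_update hr0 hr0' (N := Ns) (by rw [hsum]; exact Nat.succ_lt_succ p.2)
  have hw := hwsk.eq_zeroCycle_mul hwnu hcol (fun p => skewRow_update hr0 hr0' p)
  obtain ⟨X, -, hX⟩ := hU.exists_zeroCycle_mul_prod hU' hwsk.monotone_labelCol
    (hwsk.labelCol_lt hsize) g hgU N
  have hγ : (fun y => labelCol mu lam wsk ((wsk 0).succAbove y)) =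
      labelCol mu (Function.update lam r0 (lam r0 + 1)) wnu := by
    funext y
    have : wsk.symm ((wsk 0).succAbove y) = (wnu.symm y).succ := by
      rw [Equiv.symm_apply_eq]
      conv_rhs => rw [hw]
      simp
    rw [labelCol, labelCol, this, hcol, Fin.val_succ]
  rw [hγ] at hX
  have hUw : U wsk = g (U' wnu) * U (zeroCycle (wsk 0)) := by
    rw [hU.map_extendPerm_zero hU' g hgU, hU.mul_zeroCycle _ (extendPerm_self 0 wnu), ← hw]
  refine ⟨((((-q)⁻¹) ^ permLength wsk)⁻¹ * ((-q)⁻¹) ^ permLength wnu) •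
    (U (zeroCycle (wsk 0)) * X), ?_⟩
  have hUnu : g (U' wnu) = ((-q)⁻¹) ^ permLength wnu • g (T' wnu) := map_smul g _ _
  rw [ySkew_eq_prod_fiberSum, ySkew_eq_prod_fiberSum, hTU, hUw, smul_mul_assoc, mul_assoc,
    hX, hUnu]
  simp only [map_mul, smul_mul_assoc, mul_smul_comm, smul_smul, mul_assoc]
  rfl

end FayersSemistd
end
end
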